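/- arXiv:1512.09232 — 2 statements merged into one kernel-verified Lean document; each statement's English description precedes it below -/
import Mathlib

section
/- The map φ defined on Gr_{e+1}(V) by φ(W) = [σ(W ∩ H)] ∪ ([W] \ [H]) if W ∈ A, and φ(W) = [W] if W ⊆ H, is a graph isomorphism from the switched graph Γ̃ onto the block graph Δ(e,q); that is, φ is injective, its image is the vertex set of Δ(e,q), and for distinct W_1, W_2 ∈ Gr_{e+1}(V), W_1 and W_2 are adjacent in Γ̃ if and only if |φ(W_1) ∩ φ(W_2)| = (q^e − 1)/(q − 1). -/
/-- `[W]`: the set of `1`-dimensional subspaces of `V` contained in `W`. -/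
def projPts {F V : Type*} [Field F] [AddCommGroup V] [Module F V]
    (W : Submodule F V) : Set (Submodule F V) :=
  {L | Module.finrank F ↥L = 1 ∧ L ≤ W}

/-- `φ(W) = [σ(W ∩ H)] ∪ ([W] \ [H])` for `W ∈ A`, where `σ` is a polarity of the
hyperplane `H`. -/
def phiA {F V : Type*} [Field F] [AddCommGroup V] [Module F V]
    (H : Submodule F V) (σ : Submodule F ↥H → Submodule F ↥H)
    (W : Submodule F V) : Set (Submodule F V) :=
  projPts (Submodule.map H.subtype (σ (Submodule.comap H.subtype W))) ∪
    (projPts W \ projPts H)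

open scoped Classical in
/-- The map `φ` on `Gr_{e+1}(V)`: `φ(W) = [W]` if `W ⊆ H`, and
`φ(W) = [σ(W ∩ H)] ∪ ([W] \ [H])` otherwise (i.e. if `W ∈ A`). -/
noncomputable def phi {F V : Type*} [Field F] [AddCommGroup V] [Module F V]
    (H : Submodule F V) (σ : Submodule F ↥H → Submodule F ↥H)
    (W : Submodule F V) : Set (Submodule F V) :=
  if W ≤ H then projPts W else phiA H σ W

/-- The switched graph `Γ̃`: vertices are the `(e+1)`-dimensional subspaces of `V`, and
two distinct vertices `W₁, W₂` are adjacent iff either (i) `W₁, W₂ ∈ A` and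
`dim (W₁ ∩ W₂) = e`, or (ii) `W₁, W₂ ∈ D = Gr_{e+1}(H)` and `dim (W₁ ∩ W₂) = e`, or
(iii) one of them lies in `C_U` for some `U ∈ Gr_e(H)`, the other lies in `D`, and
`σ(U) ⊆` the latter. -/
def switchedGraph {F V : Type*} [Field F] [AddCommGroup V] [Module F V]
    (e : ℕ) (H : Submodule F V) (σ : Submodule F ↥H → Submodule F ↥H) :
    SimpleGraph {W : Submodule F V // Module.finrank F ↥W = e + 1} :=
  SimpleGraph.fromRel fun W₁ W₂ =>
    (¬ W₁.1 ≤ H ∧ ¬ W₂.1 ≤ H ∧ Module.finrank F ↥(W₁.1 ⊓ W₂.1) = e) ∨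
    (W₁.1 ≤ H ∧ W₂.1 ≤ H ∧ Module.finrank F ↥(W₁.1 ⊓ W₂.1) = e) ∨
    (∃ U : Submodule F ↥H, Module.finrank F ↥U = e ∧
      ¬ W₁.1 ≤ H ∧ Submodule.comap H.subtype W₁.1 = U ∧
      W₂.1 ≤ H ∧ Submodule.map H.subtype (σ U) ≤ W₂.1)

open Module in
lemma polarity_finrank {F M : Type*} [Field F] [AddCommGroup M] [Module F M]
    [FiniteDimensional F M] (σ : Submodule F M → Submodule F M)
    (hinv : ∀ U, σ (σ U) = U) (hanti : ∀ U U' : Submodule F M, U ≤ U' → σ U' ≤ σ U)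
    (U : Submodule F M) : finrank F (σ U) + finrank F U = finrank F M := by
  let f : Submodule F M ≃o (Submodule F M)ᵒᵈ :=
    { toFun := fun U => OrderDual.toDual (σ U)
      invFun := fun U => σ (OrderDual.ofDual U)
      left_inv := fun U => hinv U
      right_inv := fun U => congrArg OrderDual.toDual (hinv (OrderDual.ofDual U))
      map_rel_iff' := by
        intro a b
        constructor
        · intro h
          have h0 : σ b ≤ σ a := h
          have := hanti _ _ h0
          rwa [hinv, hinv] at this
        · intro h
          have h0 : σ b ≤ σ a := hanti _ _ h
          exact h0 }
  have h1 : Order.height (f (σ U)) = Order.height (σ U) := Order.height_orderIso f (σ U)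
  have h2 : f (σ U) = OrderDual.toDual U := congrArg OrderDual.toDual (hinv U)
  rw [h2, Order.height_toDual, ← Module.length_quotient, ← Module.length_submodule,
    Module.length_eq_finrank, Module.length_eq_finrank] at h1
  have h3 : finrank F (M ⧸ U) = finrank F (σ U) := by exact_mod_cast h1
  rw [← h3]
  exact Submodule.finrank_quotient_add_finrank U

lemma polarity_sup {F M : Type*} [Field F] [AddCommGroup M] [Module F M]
    (σ : Submodule F M → Submodule F M)
    (hinv : ∀ U, σ (σ U) = U) (hanti : ∀ U U' : Submodule F M, U ≤ U' → σ U' ≤ σ U)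
    (U U' : Submodule F M) : σ U ⊓ σ U' = σ (U ⊔ U') := by
  apply le_antisymm
  · have h : U ⊔ U' ≤ σ (σ U ⊓ σ U') := by
      apply sup_le
      · have := hanti _ _ (inf_le_left : σ U ⊓ σ U' ≤ σ U)
        rwa [hinv] at this
      · have := hanti _ _ (inf_le_right : σ U ⊓ σ U' ≤ σ U')
        rwa [hinv] at this
    have := hanti _ _ h
    rwa [hinv] at this
  · exact le_inf (hanti _ _ le_sup_left) (hanti _ _ le_sup_right)

/-- Number of points of a `k`-dimensional space. -/
def theta (q k : ℕ) : ℕ := ∑ i ∈ Finset.range k, q ^ i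

lemma theta_strictMono {q : ℕ} (hq : 2 ≤ q) : StrictMono (theta q) := by
  apply strictMono_nat_of_lt_succ
  intro n
  unfold theta
  rw [Finset.sum_range_succ]
  have : 0 < q ^ n := by positivity
  omega

section
variable {F V : Type*} [Field F] [Fintype F] [AddCommGroup V] [Module F V]
  [FiniteDimensional F V]

lemma projPts_ncard (W : Submodule F V) :
    (projPts W).ncard = theta (Fintype.card F) (Module.finrank F W) := by
  have h := Projectivization.card_of_finrank F W rfl
  rw [Nat.card_congr (Projectivization.equivSubmodule F W), Nat.card_eq_fintype_card (α := F)] at h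
  unfold theta
  rw [← h]
  rw [← Nat.card_coe_set_eq]
  symm
  apply Nat.card_congr
  refine Equiv.ofBijective (fun L => ⟨L.1.map W.subtype, ?_, ?_⟩) ⟨?_, ?_⟩
  · rw [Submodule.finrank_map_subtype_eq]; exact L.2
  · exact Submodule.map_subtype_le W L.1
  · intro L L' h
    apply Subtype.ext
    exact Submodule.map_injective_of_injective W.injective_subtype (congrArg Subtype.val h)
  · rintro ⟨L, hL, hLW⟩
    have e : (L.comap W.subtype).map W.subtype = L := by
      rw [Submodule.map_comap_subtype, inf_eq_right.2 hLW]
    refine ⟨⟨L.comap W.subtype, ?_⟩, Subtype.ext e⟩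
    rw [← Submodule.finrank_map_subtype_eq, e, hL]

lemma projPts_inf (W W' : Submodule F V) : projPts (W ⊓ W') = projPts W ∩ projPts W' := by
  ext L
  simp only [projPts, Set.mem_inter_iff, Set.mem_setOf_eq, le_inf_iff]
  tauto

lemma projPts_mono {W W' : Submodule F V} (h : W ≤ W') : projPts W ⊆ projPts W' :=
  fun _ hL => ⟨hL.1, hL.2.trans h⟩

lemma finite_projPts (W : Submodule F V) : (projPts W).Finite := by
  have : Finite V := Module.finite_of_finite F
  exact Set.toFinite _

lemma finrank_comap_eq (H W : Submodule F V) :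
    Module.finrank F (W.comap H.subtype) = Module.finrank F (H ⊓ W : Submodule F V) := by
  rw [← Submodule.finrank_map_subtype_eq, Submodule.map_comap_subtype]

lemma finrank_comap_A (e : ℕ) (hV : Module.finrank F V = 2 * e + 1)
    (H : Submodule F V) (hH : Module.finrank F H = 2 * e)
    (W : Submodule F V) (hW : Module.finrank F W = e + 1) (h : ¬ W ≤ H) :
    Module.finrank F (W.comap H.subtype) = e := by
  rw [finrank_comap_eq]
  have h1 := Submodule.finrank_sup_add_finrank_inf_eq H W
  have h2 : H < H ⊔ W := by
    refine lt_of_le_of_ne le_sup_left ?_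
    intro h'
    exact h (h' ▸ le_sup_right)
  have h3 := Submodule.finrank_lt_finrank_of_lt h2
  have h4 := Submodule.finrank_le (H ⊔ W)
  omega

lemma inter_AA (e : ℕ) (hV : Module.finrank F V = 2 * e + 1)
    (H : Submodule F V) (hH : Module.finrank F H = 2 * e)
    (σ : Submodule F H → Submodule F H)
    (hinv : ∀ U, σ (σ U) = U)
    (hanti : ∀ U U' : Submodule F H, U ≤ U' → σ U' ≤ σ U)
    (W W' : Submodule F V) (hW : Module.finrank F W = e + 1) (h : ¬ W ≤ H)
    (hW' : Module.finrank F W' = e + 1) (h' : ¬ W' ≤ H) :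
    (phi H σ W ∩ phi H σ W').ncard
      = theta (Fintype.card F) (Module.finrank F (W ⊓ W' : Submodule F V)) := by
  have hU := finrank_comap_A e hV H hH W hW h
  have hU' := finrank_comap_A e hV H hH W' hW' h'
  set U := W.comap H.subtype with hUd
  set U' := W'.comap H.subtype with hUd'
  have hpt : ∀ X : Submodule F H, projPts (X.map H.subtype) ⊆ projPts H :=
    fun X => projPts_mono (Submodule.map_subtype_le H X)
  have key : phi H σ W ∩ phi H σ W' =
      projPts ((σ U ⊓ σ U').map H.subtype) ∪ (projPts (W ⊓ W') \ projPts H) := by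
    rw [phi, phi, if_neg h, if_neg h', phiA, phiA, ← hUd, ← hUd',
      Submodule.map_inf _ H.injective_subtype, projPts_inf, projPts_inf]
    ext L
    have h1 := @hpt (σ U) L
    have h2 := @hpt (σ U') L
    simp only [Set.mem_inter_iff, Set.mem_union, Set.mem_diff]
    tauto
  have hd : Module.finrank F (σ U ⊓ σ U' : Submodule F H)
      = Module.finrank F (H ⊓ (W ⊓ W') : Submodule F V) := by
    have h1 := polarity_finrank σ hinv hanti (U ⊔ U')
    have h2 := Submodule.finrank_sup_add_finrank_inf_eq U U'
    rw [polarity_sup σ hinv hanti, ← finrank_comap_eq, Submodule.comap_inf]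
    rw [← hUd, ← hUd']
    omega
  rw [key, Set.ncard_union_eq ?_ (finite_projPts _) ((finite_projPts _).diff), projPts_ncard,
    Submodule.finrank_map_subtype_eq, hd, ← projPts_ncard, projPts_inf, ← projPts_ncard,
    Set.inter_comm]
  · exact Set.ncard_inter_add_ncard_diff_eq_ncard _ _ (finite_projPts _)
  · rw [Set.disjoint_left]
    intro L hL hL'
    exact hL'.2 (hpt _ hL)

lemma inter_DD (H : Submodule F V) (σ : Submodule F H → Submodule F H)
    (W W' : Submodule F V) (h : W ≤ H) (h' : W' ≤ H) :
    (phi H σ W ∩ phi H σ W').ncard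
      = theta (Fintype.card F) (Module.finrank F (W ⊓ W' : Submodule F V)) := by
  rw [phi, phi, if_pos h, if_pos h', ← projPts_inf, projPts_ncard]

lemma inter_AD (H : Submodule F V) (σ : Submodule F H → Submodule F H)
    (W W' : Submodule F V) (h : ¬ W ≤ H) (h' : W' ≤ H) :
    (phi H σ W ∩ phi H σ W').ncard
      = theta (Fintype.card F) (Module.finrank F
        ((σ (W.comap H.subtype)).map H.subtype ⊓ W' : Submodule F V)) := by
  rw [← projPts_ncard, projPts_inf, phi, phi, if_neg h, if_pos h', phiA]
  congr 1
  ext L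
  have := @projPts_mono F V _ _ _ _ _ _ _ h' L
  simp only [Set.mem_inter_iff, Set.mem_union, Set.mem_diff]
  tauto

lemma finrank_sigma_A (e : ℕ) (hV : Module.finrank F V = 2 * e + 1)
    (H : Submodule F V) (hH : Module.finrank F H = 2 * e)
    (σ : Submodule F H → Submodule F H)
    (hinv : ∀ U, σ (σ U) = U)
    (hanti : ∀ U U' : Submodule F H, U ≤ U' → σ U' ≤ σ U)
    (W : Submodule F V) (hW : Module.finrank F W = e + 1) (h : ¬ W ≤ H) :
    Module.finrank F ((σ (W.comap H.subtype)).map H.subtype) = e := by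
  rw [Submodule.finrank_map_subtype_eq]
  have h1 := polarity_finrank σ hinv hanti (W.comap H.subtype)
  have h2 := finrank_comap_A e hV H hH W hW h
  omega

lemma adj_AD (e : ℕ) (hV : Module.finrank F V = 2 * e + 1)
    (H : Submodule F V) (hH : Module.finrank F H = 2 * e)
    (σ : Submodule F H → Submodule F H)
    (hinv : ∀ U, σ (σ U) = U)
    (hanti : ∀ U U' : Submodule F H, U ≤ U' → σ U' ≤ σ U)
    (W W' : Submodule F V) (hW : Module.finrank F W = e + 1) (h : ¬ W ≤ H)
    (h' : W' ≤ H) :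
    (phi H σ W ∩ phi H σ W').ncard = theta (Fintype.card F) e ↔
      (σ (W.comap H.subtype)).map H.subtype ≤ W' := by
  rw [inter_AD H σ W W' h h', (theta_strictMono Fintype.one_lt_card).injective.eq_iff]
  have h1 := finrank_sigma_A e hV H hH σ hinv hanti W hW h
  constructor
  · intro h2
    have := Submodule.eq_of_le_of_finrank_eq
      (inf_le_left : (σ (W.comap H.subtype)).map H.subtype ⊓ W' ≤ _) (h2.trans h1.symm)
    exact inf_eq_left.1 this
  · intro h2
    rw [inf_eq_left.2 h2, h1]

lemma phi_ncard (e : ℕ) (hV : Module.finrank F V = 2 * e + 1)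
    (H : Submodule F V) (hH : Module.finrank F H = 2 * e)
    (σ : Submodule F H → Submodule F H)
    (hinv : ∀ U, σ (σ U) = U)
    (hanti : ∀ U U' : Submodule F H, U ≤ U' → σ U' ≤ σ U)
    (W : Submodule F V) (hW : Module.finrank F W = e + 1) :
    (phi H σ W).ncard = theta (Fintype.card F) (e + 1) := by
  rw [← Set.inter_self (phi H σ W)]
  by_cases h : W ≤ H
  · rw [inter_DD H σ W W h h, inf_idem, hW]
  · rw [inter_AA e hV H hH σ hinv hanti W W hW h hW h, inf_idem, hW]

lemma phi_ne_mixed (e : ℕ) (hV : Module.finrank F V = 2 * e + 1)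
    (H : Submodule F V) (hH : Module.finrank F H = 2 * e)
    (σ : Submodule F H → Submodule F H)
    (hinv : ∀ U, σ (σ U) = U)
    (hanti : ∀ U U' : Submodule F H, U ≤ U' → σ U' ≤ σ U)
    (W W' : Submodule F V) (hW : Module.finrank F W = e + 1) (h : ¬ W ≤ H)
    (h' : W' ≤ H) : phi H σ W ≠ phi H σ W' := by
  intro hE
  have h1 := inter_AD H σ W W' h h'
  rw [← hE, Set.inter_self, phi_ncard e hV H hH σ hinv hanti W hW,
    (theta_strictMono Fintype.one_lt_card).injective.eq_iff] at h1
  have h2 := finrank_sigma_A e hV H hH σ hinv hanti W hW h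
  have h3 := Submodule.finrank_mono
    (inf_le_left : (σ (W.comap H.subtype)).map H.subtype ⊓ W' ≤ _)
  omega

end

/-- The map `φ` defined on `Gr_{e+1}(V)` by
`φ(W) = [σ(W ∩ H)] ∪ ([W] \ [H])` if `W ∈ A` and `φ(W) = [W]` if `W ⊆ H` is a graph
isomorphism from the switched graph `Γ̃` onto the block graph `Δ(e,q)`: `φ` is
injective, its image is the vertex set of `Δ(e,q)` (the sets `[σ(W ∩ H)] ∪ ([W] \ [H])`
for `W ∈ A` together with the sets `[W]` for `W ∈ Gr_{e+1}(H)`), and for distinct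
`W₁, W₂ ∈ Gr_{e+1}(V)`, `W₁ ∼ W₂` in `Γ̃` iff `|φ(W₁) ∩ φ(W₂)| = (q^e − 1)/(q − 1)`. -/
theorem stmt_1 {F : Type*} [Field F] [Fintype F]
    {V : Type*} [AddCommGroup V] [Module F V] [FiniteDimensional F V]
    (q e : ℕ) (hq : Fintype.card F = q) (he : 1 ≤ e)
    (hV : Module.finrank F V = 2 * e + 1)
    (H : Submodule F V) (hH : Module.finrank F ↥H = 2 * e)
    (σ : Submodule F ↥H → Submodule F ↥H)
    (hσinv : ∀ U, σ (σ U) = U)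
    (hσanti : ∀ U U' : Submodule F ↥H, U ≤ U' → σ U' ≤ σ U) :
    Function.Injective
      (fun W : {W : Submodule F V // Module.finrank F ↥W = e + 1} => phi H σ W.1) ∧
    Set.range
      (fun W : {W : Submodule F V // Module.finrank F ↥W = e + 1} => phi H σ W.1) =
      {S : Set (Submodule F V) |
        (∃ W : Submodule F V, (Module.finrank F ↥W = e + 1 ∧ ¬ W ≤ H) ∧
          S = phiA H σ W) ∨
        (∃ W : Submodule F V, Module.finrank F ↥W = e + 1 ∧ W ≤ H ∧
          S = projPts W)} ∧
    ∀ W₁ W₂ : {W : Submodule F V // Module.finrank F ↥W = e + 1}, W₁ ≠ W₂ →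
      ((switchedGraph e H σ).Adj W₁ W₂ ↔
        (phi H σ W₁.1 ∩ phi H σ W₂.1).ncard = (q ^ e - 1) / (q - 1)) := by
  classical
  subst hq
  rw [← Nat.geomSum_eq Fintype.one_lt_card]
  change _ ∧ _ ∧ ∀ W₁ W₂ : {W : Submodule F V // Module.finrank F ↥W = e + 1}, W₁ ≠ W₂ →
      (_ ↔ _ = theta (Fintype.card F) e)
  have hinj := (theta_strictMono (q := Fintype.card F) Fintype.one_lt_card).injective
  refine ⟨?_, ?_, ?_⟩
  · rintro ⟨W, hW⟩ ⟨W', hW'⟩ hE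
    have hE : phi H σ W = phi H σ W' := hE
    apply Subtype.ext
    change W = W'
    have hc := phi_ncard e hV H hH σ hσinv hσanti W hW
    have fin : (phi H σ W ∩ phi H σ W').ncard
        = theta (Fintype.card F) (Module.finrank F (W ⊓ W' : Submodule F V)) → W = W' := by
      intro h
      rw [← hE, Set.inter_self, hc, hinj.eq_iff] at h
      have h1 := Submodule.eq_of_le_of_finrank_eq (inf_le_left : W ⊓ W' ≤ W) (by omega)
      have h2 := Submodule.eq_of_le_of_finrank_eq (inf_le_right : W ⊓ W' ≤ W') (by omega)
      exact h1.symm.trans h2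
    by_cases h : W ≤ H <;> by_cases h' : W' ≤ H
    · exact fin (inter_DD H σ W W' h h')
    · exact absurd hE.symm (phi_ne_mixed e hV H hH σ hσinv hσanti W' W hW' h' h)
    · exact absurd hE (phi_ne_mixed e hV H hH σ hσinv hσanti W W' hW h h')
    · exact fin (inter_AA e hV H hH σ hσinv hσanti W W' hW h hW' h')
  · ext S
    constructor
    · rintro ⟨⟨W, hW⟩, rfl⟩
      by_cases h : W ≤ H
      · exact Or.inr ⟨W, hW, h, if_pos h⟩
      · exact Or.inl ⟨W, ⟨hW, h⟩, if_neg h⟩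
    · rintro (⟨W, ⟨hW, h⟩, rfl⟩ | ⟨W, hW, h, rfl⟩)
      · exact ⟨⟨W, hW⟩, if_neg h⟩
      · exact ⟨⟨W, hW⟩, if_pos h⟩
  · rintro ⟨W, hW⟩ ⟨W', hW'⟩ hne
    rw [switchedGraph, SimpleGraph.fromRel_adj]
    simp only [ne_eq, hne, not_false_eq_true, true_and]
    by_cases h : W ≤ H <;> by_cases h' : W' ≤ H
    · rw [inter_DD H σ W W' h h', hinj.eq_iff, inf_comm W' W]
      simp [h, h']
    · rw [Set.inter_comm, adj_AD e hV H hH σ hσinv hσanti W' W hW' h' h]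
      simp [h, h', finrank_comap_A e hV H hH W' hW' h']
    · rw [adj_AD e hV H hH σ hσinv hσanti W W' hW h h']
      simp [h, h', finrank_comap_A e hV H hH W hW h]
    · rw [inter_AA e hV H hH σ hσinv hσanti W W' hW h hW' h', hinj.eq_iff, inf_comm W' W]
      simp [h, h']
end

section
/- The partition {{U, σ(U)} : U ∈ Gr_e(H)} of the vertex set of the Grassmann graph J_q(2e,e) is an equitable partition of J_q(2e,e). -/
/-- A partition `P` of the vertex set of a graph `G` is *equitable* if for all cells
`C, C' ∈ P` there is a constant `m` such that every vertex of `C'` has exactly `m`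
neighbors in `C`. -/
def IsEquitablePartition {X : Type*} (G : SimpleGraph X) (P : Set (Set X)) : Prop :=
  Setoid.IsPartition P ∧
    ∀ C ∈ P, ∀ C' ∈ P, ∃ m : ℕ, ∀ x ∈ C', (G.neighborSet x ∩ C).ncard = m

theorem polarity_rank_le {F : Type*} [Field F]
    {H : Type*} [AddCommGroup H] [Module F H] [FiniteDimensional F H]
    (σ : Submodule F H → Submodule F H)
    (hσinv : ∀ U, σ (σ U) = U)
    (hσanti : ∀ U U' : Submodule F H, U ≤ U' → σ U' ≤ σ U) (n : ℕ) :
    ∀ U V : Submodule F H, U ≤ V → Module.finrank F V ≤ Module.finrank F U + n →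
      Module.finrank F V + Module.finrank F (σ V) ≤
        Module.finrank F U + Module.finrank F (σ U) := by
  induction n with
  | zero =>
    intro U V h hn
    have := Submodule.eq_of_le_of_finrank_le h hn
    subst this
    exact le_rfl
  | succ n ih =>
    intro U V h hn
    rcases eq_or_lt_of_le h with h1 | h1
    · subst h1
      exact le_rfl
    obtain ⟨x, hxV, hxU⟩ := SetLike.exists_of_lt h1
    have hUW : U < U ⊔ Submodule.span F {x} := by
      refine lt_of_le_of_ne le_sup_left fun hh => hxU ?_
      rw [hh]
      exact Submodule.mem_sup_right (Submodule.mem_span_singleton_self x)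
    have hWV : U ⊔ Submodule.span F {x} ≤ V :=
      sup_le h ((Submodule.span_singleton_le_iff_mem x V).2 hxV)
    have h2 := Submodule.finrank_lt_finrank_of_lt hUW
    have h3 := Submodule.finrank_add_le_finrank_add_finrank U (Submodule.span F {x})
    have h4 : Module.finrank F (Submodule.span F {x}) ≤ 1 := by
      simpa using finrank_span_le_card (R := F) ({x} : Set H)
    have h5 := ih _ _ hWV (by omega)
    have h6 : σ (U ⊔ Submodule.span F {x}) < σ U := by
      refine lt_of_le_of_ne (hσanti _ _ hUW.le) fun hh => hUW.ne ?_
      have h8 := congrArg σ hh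
      rw [hσinv, hσinv] at h8
      exact h8.symm
    have h7 := Submodule.finrank_lt_finrank_of_lt h6
    omega

theorem polarity_rank {F : Type*} [Field F]
    {H : Type*} [AddCommGroup H] [Module F H] [FiniteDimensional F H]
    (σ : Submodule F H → Submodule F H)
    (hσinv : ∀ U, σ (σ U) = U)
    (hσanti : ∀ U U' : Submodule F H, U ≤ U' → σ U' ≤ σ U) (U : Submodule F H) :
    Module.finrank F U + Module.finrank F (σ U) = Module.finrank F H := by
  have h1 := polarity_rank_le σ hσinv hσanti (Module.finrank F U) ⊥ U bot_le (by omega)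
  have h2 := polarity_rank_le σ hσinv hσanti (Module.finrank F H) U ⊤ le_top
    (by rw [finrank_top]; omega)
  rw [finrank_bot] at h1
  rw [finrank_top] at h2
  have h3 := Submodule.finrank_le (σ (⊥ : Submodule F H))
  omega

theorem polarity_inf {F : Type*} [Field F]
    {H : Type*} [AddCommGroup H] [Module F H]
    (σ : Submodule F H → Submodule F H)
    (hσinv : ∀ U, σ (σ U) = U)
    (hσanti : ∀ U U' : Submodule F H, U ≤ U' → σ U' ≤ σ U) (U V : Submodule F H) :
    σ (U ⊓ V) = σ U ⊔ σ V := by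
  apply le_antisymm
  · rw [← hσinv (σ U ⊔ σ V)]
    apply hσanti
    apply le_inf
    · have := hσanti _ _ (le_sup_left : σ U ≤ σ U ⊔ σ V)
      rwa [hσinv] at this
    · have := hσanti _ _ (le_sup_right : σ V ≤ σ U ⊔ σ V)
      rwa [hσinv] at this
  · exact sup_le (hσanti _ _ inf_le_left) (hσanti _ _ inf_le_right)

/-- The partition `{{U, σ(U)} : U ∈ Gr_e(H)}` of the vertex set of the
Grassmann graph `J_q(2e,e)` (vertices: `e`-dimensional subspaces of the `2e`-dimensional
space `H`, adjacency: intersection of dimension `e-1`) is an equitable partition, where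
`σ` is a polarity of `H`. -/
theorem stmt_4 {F : Type*} [Field F] [Fintype F]
    {H : Type*} [AddCommGroup H] [Module F H] [FiniteDimensional F H]
    (e : ℕ) (he : 1 ≤ e) (hH : Module.finrank F H = 2 * e)
    (σ : Submodule F H → Submodule F H)
    (hσinv : ∀ U, σ (σ U) = U)
    (hσanti : ∀ U U' : Submodule F H, U ≤ U' → σ U' ≤ σ U) :
    IsEquitablePartition
      (SimpleGraph.fromRel fun U U' : {U : Submodule F H // Module.finrank F ↥U = e} =>
        Module.finrank F ↥(U.1 ⊓ U'.1) = e - 1)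
      {C | ∃ U : {U : Submodule F H // Module.finrank F ↥U = e},
        C = {U' | U'.1 = U.1 ∨ U'.1 = σ U.1}} := by
  classical
  have hr := polarity_rank σ hσinv hσanti
  have hi := polarity_inf σ hσinv hσanti
  let τ : {U : Submodule F H // Module.finrank F ↥U = e} →
      {U : Submodule F H // Module.finrank F ↥U = e} :=
    fun U => ⟨σ U.1, by have := hr U.1; have := U.2; omega⟩
  have hττ : ∀ U, τ (τ U) = U := fun U => Subtype.ext (hσinv U.1)
  have hτinj : Function.Injective τ := fun a b h => by rw [← hττ a, h, hττ]
  have hinf : ∀ U V : {U : Submodule F H // Module.finrank F ↥U = e},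
      Module.finrank F ↥((τ U).1 ⊓ (τ V).1) = Module.finrank F ↥(U.1 ⊓ V.1) := by
    intro U V
    have h1 := hr (U.1 ⊓ V.1)
    rw [hi] at h1
    have h2 := Submodule.finrank_sup_add_finrank_inf_eq (σ U.1) (σ V.1)
    have h3 := (τ U).2
    have h4 := (τ V).2
    change Module.finrank F ↥(σ U.1) = e at h3
    change Module.finrank F ↥(σ V.1) = e at h4
    change Module.finrank F ↥(σ U.1 ⊓ σ V.1) = _
    omega
  have hcell : ∀ U : {U : Submodule F H // Module.finrank F ↥U = e},
      {U' : {U : Submodule F H // Module.finrank F ↥U = e} | U'.1 = U.1 ∨ U'.1 = σ U.1}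
        = {U, τ U} := by
    intro U
    ext V
    simp [Subtype.ext_iff, τ]
  simp only [hcell]
  refine ⟨⟨?_, ?_⟩, ?_⟩
  · rintro ⟨U, hU⟩
    exact (Set.insert_nonempty _ _).ne_empty hU.symm
  · intro a
    refine ⟨{a, τ a}, ⟨⟨a, rfl⟩, by simp⟩, ?_⟩
    rintro C ⟨⟨U, rfl⟩, ha⟩
    rcases ha with ha | ha
    · rw [ha]
    · rw [Set.mem_singleton_iff] at ha
      rw [ha, hττ, Set.pair_comm]
  · rintro C ⟨U, rfl⟩ C' ⟨V, rfl⟩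
    refine ⟨((SimpleGraph.fromRel fun U U' : {U : Submodule F H // Module.finrank F ↥U = e} =>
        Module.finrank F ↥(U.1 ⊓ U'.1) = e - 1).neighborSet V ∩ {U, τ U}).ncard, fun x hx => ?_⟩
    rcases hx with rfl | hx
    · rfl
    · rw [Set.mem_singleton_iff] at hx
      subst hx
      rw [← Set.ncard_image_of_injective _ hτinj]
      congr 1
      ext W
      constructor
      · rintro ⟨Z, ⟨hZ1, hZ2⟩, rfl⟩
        refine ⟨?_, ?_⟩
        · simp only [SimpleGraph.mem_neighborSet, SimpleGraph.fromRel_adj] at hZ1 ⊢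
          have e1 := hinf (τ V) Z
          have e2 := hinf Z (τ V)
          rw [hττ] at e1 e2
          rw [e1, e2]
          exact ⟨fun h => hZ1.1 (by rw [h, hττ]), hZ1.2⟩
        · rcases hZ2 with h | h
          · right; rw [h]; rfl
          · rw [Set.mem_singleton_iff] at h
            left; rw [h, hττ]
      · rintro ⟨hW1, hW2⟩
        refine ⟨τ W, ⟨?_, ?_⟩, hττ W⟩
        · simp only [SimpleGraph.mem_neighborSet, SimpleGraph.fromRel_adj] at hW1 ⊢
          rw [hinf, hinf]
          exact ⟨fun h => hW1.1 (hτinj h), hW1.2⟩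
        · rcases hW2 with h | h
          · right; rw [h]; rfl
          · rw [Set.mem_singleton_iff] at h
            left; rw [h, hττ]
end
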